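/- For every nonnegative integer p and all real x, sum over k from 1 to p+1 of S(p+1,k) * x^k / k equals e^{-x} * sum over n ≥ 0 of (1^p + 2^p + ... + n^p) * x^n / n! (the series converges for all x). -/

import Mathlib

/-- Stirling numbers of the second kind. -/
def S2 : ℕ → ℕ → ℕ
  | 0, 0 => 1
  | 0, _ + 1 => 0
  | _ + 1, 0 => 0
  | n + 1, k + 1 => (k + 1) * S2 n (k + 1) + S2 n k

theorem S2_eq_zero_of_lt : ∀ {n k : ℕ}, n < k → S2 n k = 0
  | 0, 0, h => absurd h (lt_irrefl 0)
  | 0, _ + 1, _ => by rw [S2]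
  | _ + 1, 0, h => absurd h (Nat.not_lt_zero _)
  | n + 1, k + 1, h => by
    rw [S2, S2_eq_zero_of_lt (show n < k + 1 by omega), S2_eq_zero_of_lt (show n < k by omega)]
    simp

theorem succ_mul_descFactorial (n k : ℕ) :
    (n + 1) * n.descFactorial k = (k + 1) * n.descFactorial k + n.descFactorial (k + 1) := by
  rcases le_or_gt k n with h | h
  · obtain ⟨m, rfl⟩ := Nat.exists_eq_add_of_le h
    rw [Nat.descFactorial_succ, Nat.add_sub_cancel_left]
    ring
  · simp [Nat.descFactorial_succ, Nat.descFactorial_eq_zero_iff_lt.2 h]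

theorem succ_pow_eq_sum_S2_mul_descFactorial (n p : ℕ) :
    (n + 1) ^ p = ∑ j ∈ Finset.range (p + 1), S2 (p + 1) (j + 1) * n.descFactorial j := by
  induction p with
  | zero => simp [S2]
  | succ p ih =>
    have h_split : ∀ j, S2 (p + 1 + 1) (j + 1) * n.descFactorial j =
        (j + 1) * S2 (p + 1) (j + 1) * n.descFactorial j + S2 (p + 1) j * n.descFactorial j := by
      intro j
      rw [S2, add_mul]
    rw [Finset.sum_congr rfl fun j _ => h_split j, Finset.sum_add_distrib, Finset.sum_range_succ, S2_eq_zero_of_lt (show p + 1 < p + 1 + 1 by omega),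
      Finset.sum_range_succ' (fun j => S2 (p + 1) j * n.descFactorial j) (p + 1),
      show S2 (p + 1) 0 = 0 by rw [S2], pow_succ, ih, Finset.sum_mul, mul_zero, zero_mul,
      zero_mul, add_zero, add_zero, ← Finset.sum_add_distrib]
    refine Finset.sum_congr rfl fun j _ => ?_
    rw [mul_assoc, mul_comm (n.descFactorial j), succ_mul_descFactorial]
    ring

theorem sum_range_descFactorial (n k : ℕ) :
    (k + 1) * ∑ i ∈ Finset.range n, i.descFactorial k = n.descFactorial (k + 1) := by
  induction n with
  | zero => simp
  | succ n ih =>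
    rw [Finset.sum_range_succ, mul_add, ih, Nat.succ_descFactorial_succ, succ_mul_descFactorial,
      add_comm]

theorem sum_Icc_pow_eq_sum_S2_mul_descFactorial (n p : ℕ) :
    ∑ i ∈ Finset.Icc 1 n, (i : ℝ) ^ p =
      ∑ k ∈ Finset.Icc 1 (p + 1), (S2 (p + 1) k : ℝ) / k * n.descFactorial k := by
  have h_shift : ∀ (f : ℕ → ℝ) (m : ℕ),
      ∑ i ∈ Finset.Icc 1 m, f i = ∑ i ∈ Finset.range m, f (i + 1) := by
    intro f m
    rw [Finset.range_eq_Ico, Finset.sum_Ico_add' f 0 m 1]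
    rfl
  rw [h_shift, h_shift]
  have h_pow : ∀ i : ℕ, ((i + 1 : ℕ) : ℝ) ^ p =
      ∑ j ∈ Finset.range (p + 1), (S2 (p + 1) (j + 1) : ℝ) * i.descFactorial j := by
    intro i
    exact_mod_cast succ_pow_eq_sum_S2_mul_descFactorial i p
  simp_rw [h_pow]
  rw [Finset.sum_comm]
  refine Finset.sum_congr rfl fun j _ => ?_
  rw [← Finset.mul_sum, ← sum_range_descFactorial]
  push_cast
  field_simp

theorem hasSum_descFactorial_mul_pow_div_factorial (k : ℕ) (x : ℝ) :
    HasSum (fun n : ℕ => (n.descFactorial k : ℝ) * x ^ n / n.factorial) (x ^ k * Real.exp x) := by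
  rw [← hasSum_nat_add_iff' k, Finset.sum_eq_zero, sub_zero]
  · have h_exp : HasSum (fun n : ℕ => x ^ n / n.factorial) (Real.exp x) := by
      rw [Real.exp_eq_exp_ℝ]
      exact NormedSpace.expSeries_div_hasSum_exp x
    refine (h_exp.mul_left (x ^ k)).congr_fun fun n => ?_
    have h_fact := Nat.factorial_mul_descFactorial (Nat.le_add_left k n)
    rw [Nat.add_sub_cancel] at h_fact
    have h_ne : ((n + k).descFactorial k : ℝ) ≠ 0 := by
      exact_mod_cast (Nat.descFactorial_pos.2 (Nat.le_add_left k n)).ne'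
    rw [← h_fact]
    push_cast
    field_simp
    ring
  · intro n hn
    simp [Nat.descFactorial_eq_zero_iff_lt.2 (Finset.mem_range.1 hn)]

theorem stirling2_div_k_eq_power_sum_series (p : ℕ) (x : ℝ) :
    Summable (fun n : ℕ => (∑ i ∈ Finset.Icc 1 n, (i : ℝ) ^ p) * x ^ n / (Nat.factorial n)) ∧
    ∑ k ∈ Finset.Icc 1 (p + 1), (S2 (p + 1) k : ℝ) * x ^ k / k =
      Real.exp (-x) *
        ∑' n : ℕ, (∑ i ∈ Finset.Icc 1 n, (i : ℝ) ^ p) * x ^ n / (Nat.factorial n) := by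
  have h_sum : HasSum
      (fun n : ℕ => (∑ i ∈ Finset.Icc 1 n, (i : ℝ) ^ p) * x ^ n / (Nat.factorial n))
      (∑ k ∈ Finset.Icc 1 (p + 1), (S2 (p + 1) k : ℝ) / k * (x ^ k * Real.exp x)) := by
    refine (hasSum_sum fun k (_ : k ∈ Finset.Icc 1 (p + 1)) =>
      (hasSum_descFactorial_mul_pow_div_factorial k x).mul_left
        ((S2 (p + 1) k : ℝ) / k)).congr_fun fun n => ?_
    rw [sum_Icc_pow_eq_sum_S2_mul_descFactorial, Finset.sum_mul, Finset.sum_div]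
    exact Finset.sum_congr rfl fun k _ => by ring
  refine ⟨h_sum.summable, ?_⟩
  rw [h_sum.tsum_eq, Finset.mul_sum]
  refine Finset.sum_congr rfl fun k _ => ?_
  rw [Real.exp_neg]
  field_simp
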